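/- Let $d\ge 3$, $0<\eta<1$, and let $p$ be a symmetric nearest-neighbor kernel on $\mathbb{Z}^d$ close enough to the simple random walk kernel. There exists $C=C(d,\eta)$ such that for all $L$ large, all $x\in V_{\eta L}$ and $z\in\partial V_L$: $C^{-1}L^{-(d-1)} \le \pi^{(p)}_L(x,z) \le C\,L^{-(d-1)}$, where $\pi^{(p)}_L(x,z)$ is the probability that the walk started at $x$ exits the ball $V_L$ precisely at $z$. -/

import Mathlib

open scoped Classical

noncomputable section

/-- The standard unit vector `e i` in `ℤ^d`. -/
def unitVec {d : ℕ} (i : Fin d) : Fin d → ℤ := fun j => if j = i then 1 else 0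

/-- Euclidean norm of a lattice point. -/
def znorm {d : ℕ} (x : Fin d → ℤ) : ℝ := Real.sqrt (∑ i, ((x i : ℝ))^2)

/-- One step of the symmetric nearest-neighbor walk with kernel `p`. -/
def stepOp {d : ℕ} (p : Fin d → ℝ) (f : (Fin d → ℤ) → ℝ) : (Fin d → ℤ) → ℝ :=
  fun x => ∑ i, p i * (f (x + unitVec i) + f (x - unitVec i))

/-- One step of the walk absorbed on the set `A`. -/
def stopOp {d : ℕ} (p : Fin d → ℝ) (A : Set (Fin d → ℤ)) (f : (Fin d → ℤ) → ℝ) :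
    (Fin d → ℤ) → ℝ :=
  fun x => if x ∈ A then f x else stepOp p f x

/-- `exitProb p L x z`: probability that the `p`-walk started at `x` exits the ball
`V_L = {y : |y| ≤ L}` precisely at `z`. -/
def exitProb {d : ℕ} (p : Fin d → ℝ) (L : ℝ) (x z : Fin d → ℤ) : ℝ :=
  ⨆ n : ℕ, (stopOp p {y | L < znorm y})^[n]
    (fun y => if L < znorm y ∧ y = z then (1:ℝ) else 0) x

/-- The outer boundary `∂V_L` of the discrete ball `V_L`. -/
def outerBoundary (d : ℕ) (L : ℝ) : Set (Fin d → ℤ) :=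
  {z | L < znorm z ∧ ∃ i : Fin d, znorm (z - unitVec i) ≤ L ∨ znorm (z + unitVec i) ≤ L}



section Aux

lemma stepOp_add {d : ℕ} (p : Fin d → ℝ) (f g : (Fin d → ℤ) → ℝ) (x : Fin d → ℤ) :
    stepOp p (fun y => f y + g y) x = stepOp p f x + stepOp p g x := by
  simp only [stepOp, ← Finset.sum_add_distrib]
  exact Finset.sum_congr rfl fun i _ => by ring

lemma stepOp_sub {d : ℕ} (p : Fin d → ℝ) (f g : (Fin d → ℤ) → ℝ) (x : Fin d → ℤ) :
    stepOp p (fun y => f y - g y) x = stepOp p f x - stepOp p g x := by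
  simp only [stepOp, ← Finset.sum_sub_distrib]
  exact Finset.sum_congr rfl fun i _ => by ring

lemma stepOp_smul {d : ℕ} (p : Fin d → ℝ) (c : ℝ) (f : (Fin d → ℤ) → ℝ) (x : Fin d → ℤ) :
    stepOp p (fun y => c * f y) x = c * stepOp p f x := by
  simp only [stepOp, Finset.mul_sum]
  exact Finset.sum_congr rfl fun i _ => by ring

lemma stepOp_const {d : ℕ} (p : Fin d → ℝ) (hs : ∑ i, 2 * p i = 1) (c : ℝ) (x : Fin d → ℤ) :
    stepOp p (fun _ => c) x = c := by
  have : stepOp p (fun _ => c) x = (∑ i, 2 * p i) * c := by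
    simp only [stepOp, Finset.sum_mul]
    exact Finset.sum_congr rfl fun i _ => by ring
  rw [this, hs, one_mul]

lemma stepOp_mono {d : ℕ} (p : Fin d → ℝ) (hp : ∀ i, 0 ≤ p i) {f g : (Fin d → ℤ) → ℝ}
    (x : Fin d → ℤ) (h : ∀ y, f y ≤ g y) : stepOp p f x ≤ stepOp p g x := by
  unfold stepOp
  gcongr with i
  · exact hp i
  · exact h _
  · exact h _

lemma stepOp_ge_add {d : ℕ} (p : Fin d → ℝ) (hp : ∀ i, 0 ≤ p i) {f : (Fin d → ℤ) → ℝ}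
    (x : Fin d → ℤ) (h : ∀ y, 0 ≤ f y) (i : Fin d) :
    p i * f (x + unitVec i) ≤ stepOp p f x ∧ p i * f (x - unitVec i) ≤ stepOp p f x := by
  have h1 : p i * (f (x + unitVec i) + f (x - unitVec i)) ≤ stepOp p f x := by
    unfold stepOp
    exact Finset.single_le_sum
      (f := fun i => p i * (f (x + unitVec i) + f (x - unitVec i)))
      (fun j _ => mul_nonneg (hp j) (add_nonneg (h _) (h _))) (Finset.mem_univ i)
  have h2 := mul_nonneg (hp i) (h (x + unitVec i))
  have h3 := mul_nonneg (hp i) (h (x - unitVec i))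
  constructor <;> linarith [mul_add (p i) (f (x + unitVec i)) (f (x - unitVec i))]

/-- maximum principle -/
lemma max_principle {d : ℕ} (hd : 0 < d) (p : Fin d → ℝ) (hp : ∀ i, 0 < p i)
    (hs : ∑ i, 2 * p i = 1)
    (D : Set (Fin d → ℤ)) (hD : D.Finite) (φ : (Fin d → ℤ) → ℝ)
    (hsub : ∀ y ∈ D, φ y ≤ stepOp p φ y)
    (hb : ∀ y ∈ D, ∀ i, (y + unitVec i ∉ D → φ (y + unitVec i) ≤ 0) ∧
      (y - unitVec i ∉ D → φ (y - unitVec i) ≤ 0)) :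
    ∀ y ∈ D, φ y ≤ 0 := by
  intro y₀ hy₀
  by_contra! hpos
  obtain ⟨y₁, hy₁, hmax⟩ := D.exists_max_image φ hD ⟨y₀, hy₀⟩
  have hm : 0 < φ y₁ := lt_of_lt_of_le hpos (hmax _ hy₀)
  let i0 : Fin d := ⟨0, hd⟩
  obtain ⟨y₂, ⟨hy₂, he⟩, hmax2⟩ := (D ∩ {y | φ y = φ y₁}).exists_max_image
    (fun y => y i0) (hD.subset Set.inter_subset_left) ⟨y₁, hy₁, rfl⟩
  simp only [Set.mem_ofPred_eq] at he
  have hle : ∀ i, φ (y₂ + unitVec i) ≤ φ y₁ ∧ φ (y₂ - unitVec i) ≤ φ y₁ := by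
    intro i
    constructor
    · by_cases h : y₂ + unitVec i ∈ D
      · exact hmax _ h
      · linarith [(hb _ hy₂ i).1 h]
    · by_cases h : y₂ - unitVec i ∈ D
      · exact hmax _ h
      · linarith [(hb _ hy₂ i).2 h]
  have heq : φ (y₂ + unitVec i0) = φ y₁ := by
    by_contra hne
    have hlt : φ (y₂ + unitVec i0) < φ y₁ := lt_of_le_of_ne (hle i0).1 hne
    have h1 : stepOp p φ y₂ < ∑ i, p i * (φ y₁ + φ y₁) := by
      unfold stepOp
      apply Finset.sum_lt_sum
      · intro i _
        exact mul_le_mul_of_nonneg_left (add_le_add (hle i).1 (hle i).2) (hp i).le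
      · exact ⟨i0, Finset.mem_univ _,
          mul_lt_mul_of_pos_left (add_lt_add_of_lt_of_le hlt (hle i0).2) (hp i0)⟩
    have h2 : ∑ i, p i * (φ y₁ + φ y₁) = φ y₁ := by
      have := stepOp_const p hs (φ y₁) y₁
      simpa [stepOp] using this
    linarith [hsub _ hy₂]
  have hmem : y₂ + unitVec i0 ∈ D := by
    by_contra h
    linarith [(hb _ hy₂ i0).1 h]
  have := hmax2 _ ⟨hmem, heq⟩
  simp [unitVec] at this

/-- `g` is the Green function of `V` with pole `b`. -/
def IsGreen {d : ℕ} (p : Fin d → ℝ) (V : Set (Fin d → ℤ)) (b : Fin d → ℤ)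
    (g : (Fin d → ℤ) → ℝ) : Prop :=
  (∀ y, y ∉ V → g y = 0) ∧ ∀ y ∈ V, g y = stepOp p g y + if y = b then 1 else 0

lemma exists_green {d : ℕ} (hd : 0 < d) (p : Fin d → ℝ) (hp : ∀ i, 0 < p i)
    (hs : ∑ i, 2 * p i = 1) (V : Set (Fin d → ℤ)) (hV : V.Finite) (b : Fin d → ℤ) :
    ∃ g, IsGreen p V b g := by
  have : Fintype V := hV.fintype
  let ext : (V → ℝ) → (Fin d → ℤ) → ℝ := fun f y => if h : y ∈ V then f ⟨y, h⟩ else 0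
  have hadd : ∀ f g, ext (f + g) = fun y => ext f y + ext g y := by
    intro f g; funext y; simp only [ext]; split_ifs <;> simp
  have hsmul : ∀ (c : ℝ) f, ext (c • f) = fun y => c * ext f y := by
    intro f g; funext y; simp only [ext]; split_ifs <;> simp
  let T : (V → ℝ) →ₗ[ℝ] (V → ℝ) :=
    { toFun := fun f x => ext f x - stepOp p (ext f) x
      map_add' := by
        intro f g; funext x
        rw [hadd, stepOp_add]; simp only [Pi.add_apply]; ring
      map_smul' := by
        intro c f; funext x
        rw [hsmul, stepOp_smul]; simp only [Pi.smul_apply, smul_eq_mul, RingHom.id_apply]; ring }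
  have hinj : Function.Injective T := by
    rw [injective_iff_map_eq_zero]
    intro f hf
    have hz : ∀ y ∈ V, ext f y = stepOp p (ext f) y := by
      intro y hy
      have := congrFun hf ⟨y, hy⟩
      simp only [T, LinearMap.coe_mk, AddHom.coe_mk, Pi.zero_apply] at this
      linarith
    have hout : ∀ y, y ∉ V → ext f y = 0 := by intro y hy; simp [ext, hy]
    have h1 := max_principle hd p hp hs V hV (ext f) (fun y hy => (hz y hy).le)
      (fun y _ i => ⟨fun h => (hout _ h).le, fun h => (hout _ h).le⟩)
    have h2 := max_principle hd p hp hs V hV (fun y => (-1) * ext f y)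
      (fun y hy => by rw [stepOp_smul, ← hz y hy])
      (fun y _ i => ⟨fun h => by simp [hout _ h], fun h => by simp [hout _ h]⟩)
    funext ⟨y, hy⟩
    have a := h1 y hy
    have b := h2 y hy
    simp only [ext, hy, dite_true] at a b
    simp only [Pi.zero_apply]
    linarith
  obtain ⟨f, hf⟩ := (LinearMap.injective_iff_surjective.1 hinj) (fun y => if (y : Fin d → ℤ) = b then 1 else 0)
  refine ⟨ext f, fun y hy => by simp [ext, hy], fun y hy => ?_⟩
  have := congrFun hf ⟨y, hy⟩
  simp only [T, LinearMap.coe_mk, AddHom.coe_mk] at this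
  linarith

lemma IsGreen.nonneg {d : ℕ} (hd : 0 < d) {p : Fin d → ℝ} (hp : ∀ i, 0 < p i)
    (hs : ∑ i, 2 * p i = 1) {V : Set (Fin d → ℤ)} (hV : V.Finite) {b : Fin d → ℤ}
    {g : (Fin d → ℤ) → ℝ} (hg : IsGreen p V b g) (y : Fin d → ℤ) : 0 ≤ g y := by
  by_cases hy : y ∈ V
  · have h2 := max_principle hd p hp hs V hV (fun y => (-1) * g y)
      (fun y hy => by
        rw [stepOp_smul, hg.2 y hy]
        split_ifs <;> linarith)
      (fun y _ i => ⟨fun h => by simp [hg.1 _ h], fun h => by simp [hg.1 _ h]⟩) y hy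
    linarith
  · rw [hg.1 y hy]

lemma summable_of_supp {d : ℕ} {V : Set (Fin d → ℤ)} (hV : V.Finite)
    {f : (Fin d → ℤ) → ℝ} (hf : ∀ y, y ∉ V → f y = 0) : Summable f := by
  apply summable_of_ne_finset_zero (s := hV.toFinset)
  intro b hb
  exact hf b (by simpa using hb)

lemma stepOp_symm {d : ℕ} (p : Fin d → ℝ) {V W : Set (Fin d → ℤ)} (hV : V.Finite)
    (hW : W.Finite) {f g : (Fin d → ℤ) → ℝ} (hf : ∀ y, y ∉ V → f y = 0)
    (hg : ∀ y, y ∉ W → g y = 0) :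
    ∑' x, f x * stepOp p g x = ∑' x, stepOp p f x * g x := by
  have e1 : ∀ x, f x * stepOp p g x =
      ∑ i, (p i * (f x * g (x + unitVec i)) + p i * (f x * g (x - unitVec i))) := by
    intro x; simp only [stepOp, Finset.mul_sum]
    exact Finset.sum_congr rfl fun i _ => by ring
  have e2 : ∀ x, stepOp p f x * g x =
      ∑ i, (p i * (f (x - unitVec i) * g x) + p i * (f (x + unitVec i) * g x)) := by
    intro x; simp only [stepOp, Finset.sum_mul]
    exact Finset.sum_congr rfl fun i _ => by ring
  have s1 : ∀ v, Summable (fun x => f x * g (x + v)) := fun v =>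
    summable_of_supp hV (fun y hy => by simp [hf y hy])
  have s1' : ∀ v, Summable (fun x => f x * g (x - v)) := fun v =>
    summable_of_supp hV (fun y hy => by simp [hf y hy])
  have s2 : ∀ v, Summable (fun x => f (x + v) * g x) := fun v =>
    summable_of_supp hW (fun y hy => by simp [hg y hy])
  have s2' : ∀ v, Summable (fun x => f (x - v) * g x) := fun v =>
    summable_of_supp hW (fun y hy => by simp [hg y hy])
  simp_rw [e1, e2]
  rw [Summable.tsum_finsetSum, Summable.tsum_finsetSum]
  · refine Finset.sum_congr rfl fun i _ => ?_
    rw [Summable.tsum_add, Summable.tsum_add]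
    · simp only [tsum_mul_left]
      congr 2
      · rw [← (Equiv.subRight (unitVec i)).tsum_eq (fun x => f x * g (x + unitVec i))]
        simp
      · rw [← (Equiv.addRight (unitVec i)).tsum_eq (fun x => f x * g (x - unitVec i))]
        simp
    · exact (s2' _).mul_left _
    · exact (s2 _).mul_left _
    · exact (s1 _).mul_left _
    · exact (s1' _).mul_left _
  · exact fun i _ => ((s2' _).mul_left _).add ((s2 _).mul_left _)
  · exact fun i _ => ((s1 _).mul_left _).add ((s1' _).mul_left _)

/-- pairing of a Green function with a function supported on `V` -/
lemma IsGreen.pair {d : ℕ} {p : Fin d → ℝ} {V : Set (Fin d → ℤ)} {b : Fin d → ℤ}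
    {g : (Fin d → ℤ) → ℝ} (hV : V.Finite) (hg : IsGreen p V b g)
    {f : (Fin d → ℤ) → ℝ} (hf : ∀ y, y ∉ V → f y = 0) :
    f b = ∑' x, (f x - stepOp p f x) * g x := by
  have e : ∀ x, f x * g x - f x * stepOp p g x = if x = b then f b else 0 := by
    intro x
    by_cases hx : x ∈ V
    · rw [hg.2 x hx]
      split_ifs with h
      · subst h; ring
      · ring
    · rw [hf x hx]
      split_ifs with h
      · subst h; rw [hf x hx]; ring
      · ring
  have h1 : ∑' x, (f x * g x - f x * stepOp p g x) = f b := by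
    simp_rw [e]; exact tsum_ite_eq b _
  rw [Summable.tsum_sub, stepOp_symm p hV hV hf hg.1, ← Summable.tsum_sub] at h1
  · rw [← h1]; congr 1; funext x; ring
  · exact summable_of_supp hV (fun y hy => by simp [hf y hy])
  · exact summable_of_supp hV (fun y hy => by simp [hg.1 y hy])
  · exact summable_of_supp hV (fun y hy => by simp [hf y hy])
  · exact summable_of_supp hV (fun y hy => by simp [hf y hy])

lemma IsGreen.symm {d : ℕ} {p : Fin d → ℝ} {V : Set (Fin d → ℤ)} {a b : Fin d → ℤ}
    {f g : (Fin d → ℤ) → ℝ} (hV : V.Finite) (ha : a ∈ V)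
    (hf : IsGreen p V a f) (hg : IsGreen p V b g) : f b = g a := by
  rw [hg.pair hV hf.1]
  have : ∀ x, (f x - stepOp p f x) * g x = if x = a then g a else 0 := by
    intro x
    by_cases hx : x ∈ V
    · rw [hf.2 x hx]; split_ifs with h
      · subst h; ring
      · ring
    · rw [hg.1 x hx]; split_ifs with h
      · subst h; exact absurd ha hx
      · ring
  simp_rw [this]; exact tsum_ite_eq a _

lemma exitProb_harm {d : ℕ} (p : Fin d → ℝ) (hp : ∀ i, 0 ≤ p i) (hs : ∑ i, 2 * p i = 1)
    (L : ℝ) (z : Fin d → ℤ) :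
    (∀ x, L < znorm x → exitProb p L x z = if x = z then 1 else 0) ∧
    (∀ x, ¬ L < znorm x → exitProb p L x z = stepOp p (fun y => exitProb p L y z) x) := by
  set A : Set (Fin d → ℤ) := {y | L < znorm y} with hA
  set f0 : (Fin d → ℤ) → ℝ := fun y => if L < znorm y ∧ y = z then (1:ℝ) else 0 with hf0
  have hTmono : ∀ f g : (Fin d → ℤ) → ℝ, f ≤ g → stopOp p A f ≤ stopOp p A g := by
    intro f g h x
    unfold stopOp
    split_ifs
    · exact h x
    · exact stepOp_mono p hp x h
  have hsucc : ∀ n, (stopOp p A)^[n] f0 ≤ (stopOp p A)^[n+1] f0 := by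
    intro n
    induction n with
    | zero =>
      intro x
      simp only [Function.iterate_zero, id_eq, zero_add, Function.iterate_one]
      unfold stopOp
      split_ifs with h
      · exact le_rfl
      · have : f0 x = 0 := by
          simp only [hf0]; rw [if_neg]; rintro ⟨h1, -⟩; exact h h1
        rw [this, ← stepOp_const p hs 0 x]
        apply stepOp_mono p hp
        intro y; simp only [hf0]; split_ifs <;> norm_num
    | succ n ih =>
      rw [Function.iterate_succ_apply', Function.iterate_succ_apply' _ (n+1)]
      exact hTmono _ _ ih
  have hmono : Monotone (fun n => (stopOp p A)^[n] f0) := monotone_nat_of_le_succ hsucc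
  have hbd : ∀ n x, (stopOp p A)^[n] f0 x ≤ 1 := by
    intro n
    induction n with
    | zero => intro x; simp only [Function.iterate_zero, id_eq, hf0]; split_ifs <;> norm_num
    | succ n ih =>
      intro x
      rw [Function.iterate_succ_apply']
      unfold stopOp
      split_ifs
      · exact ih x
      · rw [← stepOp_const p hs 1 x]; exact stepOp_mono p hp x ih
  have hlim : ∀ x, Filter.Tendsto (fun n => (stopOp p A)^[n] f0 x) Filter.atTop
      (nhds (exitProb p L x z)) := by
    intro x
    exact tendsto_atTop_ciSup (fun m n h => hmono h x) ⟨1, by rintro _ ⟨n, rfl⟩; exact hbd n x⟩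
  constructor
  · intro x hx
    have hc : ∀ n, (stopOp p A)^[n] f0 x = if x = z then 1 else 0 := by
      intro n
      induction n with
      | zero => simp [hf0, hx]
      | succ n ih =>
        rw [Function.iterate_succ_apply', ← ih]
        unfold stopOp
        rw [if_pos (show x ∈ A from hx)]
    have := hlim x
    simp_rw [hc] at this
    exact tendsto_nhds_unique this tendsto_const_nhds
  · intro x hx
    have h1 := (Filter.tendsto_add_atTop_iff_nat 1).2 (hlim x)
    have h2 : Filter.Tendsto (fun n => (stopOp p A)^[n+1] f0 x) Filter.atTop
        (nhds (stepOp p (fun y => exitProb p L y z) x)) := by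
      have : ∀ n, (stopOp p A)^[n+1] f0 x = stepOp p ((stopOp p A)^[n] f0) x := by
        intro n
        rw [Function.iterate_succ_apply']
        conv_lhs => unfold stopOp
        rw [if_neg (show x ∉ A from hx)]
        rfl
      simp_rw [this]
      unfold stepOp
      exact tendsto_finsetSum _ fun i _ => ((hlim _).add (hlim _)).const_mul _
    exact tendsto_nhds_unique h1 h2

lemma exitProb_eq_green {d : ℕ} (p : Fin d → ℝ) (hp : ∀ i, 0 ≤ p i) (hs : ∑ i, 2 * p i = 1)
    (L : ℝ) (z b : Fin d → ℤ) (hV : {y : Fin d → ℤ | znorm y ≤ L}.Finite)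
    (hz : L < znorm z) (hb : znorm b ≤ L) {g : (Fin d → ℤ) → ℝ}
    (hg : IsGreen p {y : Fin d → ℤ | znorm y ≤ L} b g) :
    exitProb p L b z = stepOp p g z := by
  obtain ⟨h1, h2⟩ := exitProb_harm p hp hs L z
  set V := {y : Fin d → ℤ | znorm y ≤ L} with hVd
  set ft : (Fin d → ℤ) → ℝ := fun x => if znorm x ≤ L then exitProb p L x z else 0 with hft
  set iz : (Fin d → ℤ) → ℝ := fun x => if x = z then 1 else 0 with hiz
  have hsplit : (fun y => exitProb p L y z) = fun y => ft y + iz y := by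
    funext y
    simp only [hft, hiz]
    by_cases hy : znorm y ≤ L
    · have : y ≠ z := by rintro rfl; linarith
      simp [hy, this]
    · simp [hy, h1 y (not_le.1 hy)]
  have hft0 : ∀ y, y ∉ V → ft y = 0 := by
    intro y hy; simp only [hft]; exact if_neg hy
  have hp1 := hg.pair hV hft0
  have hfb : ft b = exitProb p L b z := by simp [hft, hb]
  rw [← hfb, hp1]
  have h3 : ∀ x, (ft x - stepOp p ft x) * g x = stepOp p iz x * g x := by
    intro x
    by_cases hx : x ∈ V
    · have h4 := h2 x (not_lt.2 hx)
      rw [hsplit, stepOp_add] at h4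
      have h5 : ft x = exitProb p L x z := by
        simp only [hft]; exact if_pos hx
      rw [h5, h4]; ring
    · simp [hg.1 x hx]
  simp_rw [h3]
  rw [← stepOp_symm p (Set.finite_singleton z) hV (f := iz) (g := g) _ hg.1]
  · have : ∀ x, iz x * stepOp p g x = if x = z then stepOp p g z else 0 := by
      intro x; simp only [hiz]; split_ifs with h
      · subst h; ring
      · ring
    simp_rw [this]; exact tsum_ite_eq z _
  · intro y hy; simp only [hiz]; exact if_neg hy



lemma rpow_taylor (β : ℝ) : ∃ γ M δ : ℝ, 0 ≤ M ∧ 0 < δ ∧ ∀ u : ℝ, |u| ≤ δ →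
    |(1 + u) ^ (-β) - (1 - β * u + β * (β + 1) / 2 * u ^ 2 + γ * u ^ 3)| ≤ M * u ^ 4 := by
  have h := (Real.one_add_rpow_hasFPowerSeriesAt_zero (a := -β)).isBigO_sub_partialSum_pow 4
  obtain ⟨M, hM, h⟩ := h.exists_nonneg
  rw [Asymptotics.IsBigOWith] at h
  obtain ⟨δ, hδ, h⟩ := Metric.eventually_nhds_iff.1 h
  refine ⟨Ring.choose (-β) 3, M, δ / 2, hM, by linarith, fun u hu => ?_⟩
  have := @h u (by rw [Real.dist_eq, sub_zero]; linarith)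
  simp only [zero_add, norm_pow, Real.norm_eq_abs, abs_abs, FormalMultilinearSeries.partialSum,
    Finset.sum_range_succ, binomialSeries, Finset.sum_range_zero] at this
  have e4 : |u| ^ 4 = u ^ 4 := by rw [← abs_pow, abs_of_nonneg (by positivity)]
  rw [e4] at this
  have c2 : Ring.choose (-β) 2 = β * (β + 1) / 2 := by
    rw [Ring.choose_eq_smul]
    have : (descPochhammer ℤ 2) = Polynomial.X ^ 2 - Polynomial.X := by
      simp [descPochhammer_succ_right]; ring
    rw [this, Polynomial.smeval_sub, Polynomial.smeval_X, Polynomial.smeval_X_pow]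
    simp [Nat.factorial]
    ring
  rw [pow_succ u 2, sq u, mul_assoc u u u]
  simpa [FormalMultilinearSeries.ofScalars, Ring.choose_zero_right, Ring.choose_one_right, c2, sub_eq_add_neg] using this

set_option maxHeartbeats 800000 in
/-- one-dimensional second difference estimate -/
lemma rpow_second_diff (β A B : ℝ) (hβ : 0 < β) (hA : 0 ≤ A) (hB : 0 ≤ B) :
    ∃ C S : ℝ, 0 ≤ C ∧ 1 ≤ S ∧ ∀ s b c : ℝ, S ≤ s → 0 ≤ b → b ≤ B → c ^ 2 ≤ A * s →
      |(s + b + c) ^ (-β) + (s + b - c) ^ (-β)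
        - s ^ (-β) * (2 - 2 * β * b / s + β * (β + 1) * c ^ 2 / s ^ 2)| ≤ C * (s ^ (-β) / s ^ 2) := by
  obtain ⟨γ, M, δ, hM, hδ, hT⟩ := rpow_taylor β
  set δ' := min δ (1/2) with hδ'
  have hδ'0 : 0 < δ' := by positivity
  refine ⟨β * (β + 1) * B ^ 2 + |γ| * (2 * B ^ 3 + 6 * B * A) + M * (2 * (8 * (B ^ 4 + A ^ 2))),
    max (max 1 (2 * B / δ')) (4 * A / δ' ^ 2), by positivity, by simp, ?_⟩
  intro s b c hs hb hbB hc
  have hs1 : 1 ≤ s := le_trans (by simp) hs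
  have hs2 : 2 * B / δ' ≤ s := le_trans (by simp) hs
  have hs3 : 4 * A / δ' ^ 2 ≤ s := le_trans (by simp) hs
  have hs0 : 0 < s := by linarith
  rw [div_le_iff₀ hδ'0] at hs2
  rw [div_le_iff₀ (by positivity)] at hs3
  have hcabs : |c| ≤ s * δ' / 2 := by
    apply abs_le_of_sq_le_sq _ (by positivity)
    nlinarith
  have hu : ∀ h : ℝ, |h| ≤ b + |c| → |h / s| ≤ δ' := by
    intro h hh
    rw [abs_div, abs_of_pos hs0, div_le_iff₀ hs0]
    linarith
  have hh1 : |b + c| ≤ b + |c| := by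
    calc |b + c| ≤ |b| + |c| := abs_add_le _ _
      _ = _ := by rw [abs_of_nonneg hb]
  have hh2 : |b - c| ≤ b + |c| := by
    calc |b - c| ≤ |b| + |c| := abs_sub _ _
      _ = _ := by rw [abs_of_nonneg hb]
  have key : ∀ h : ℝ, |h| ≤ b + |c| → (s + h) ^ (-β) = s ^ (-β) * (1 + h / s) ^ (-β) := by
    intro h hh
    have := (abs_le.1 (hu h hh)).1
    have h12 : δ' ≤ 1 / 2 := min_le_right _ _
    rw [← Real.mul_rpow hs0.le (by linarith)]
    congr 1; field_simp
  have t1 := hT ((b + c) / s) (le_trans (hu _ hh1) (min_le_left _ _))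
  have t2 := hT ((b - c) / s) (le_trans (hu _ hh2) (min_le_left _ _))
  have k1 := key _ hh1
  have k2 := key _ hh2
  rw [show s + b + c = s + (b + c) by ring, show s + b - c = s + (b - c) by ring, k1, k2]
  set X := (1 + (b + c) / s) ^ (-β)
  set Y := (1 + (b - c) / s) ^ (-β)
  have hsβ : 0 < s ^ (-β) := Real.rpow_pos_of_pos hs0 _
  rw [← mul_add, ← mul_sub, abs_mul, abs_of_pos hsβ]
  refine (mul_le_mul_of_nonneg_left (?_ : _ ≤ (β * (β + 1) * B ^ 2 + |γ| * (2 * B ^ 3 + 6 * B * A)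
    + M * (2 * (8 * (B ^ 4 + A ^ 2)))) / s ^ 2) hsβ.le).trans_eq (by ring)
  set a1 := 1 - β * ((b + c) / s) + β * (β + 1) / 2 * ((b + c) / s) ^ 2 + γ * ((b + c) / s) ^ 3 with ha1
  set a2 := 1 - β * ((b - c) / s) + β * (β + 1) / 2 * ((b - c) / s) ^ 2 + γ * ((b - c) / s) ^ 3 with ha2
  have hsum : a1 + a2 = (2 - 2 * β * b / s + β * (β + 1) * c ^ 2 / s ^ 2)
      + β * (β + 1) * b ^ 2 / s ^ 2 + γ * (2 * b ^ 3 + 6 * b * c ^ 2) / s ^ 3 := by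
    rw [ha1, ha2]; field_simp; ring
  have e1 : |β * (β + 1) * b ^ 2 / s ^ 2| ≤ β * (β + 1) * B ^ 2 / s ^ 2 := by
    rw [abs_of_nonneg (by positivity)]; gcongr
  have e2 : |γ * (2 * b ^ 3 + 6 * b * c ^ 2) / s ^ 3| ≤ |γ| * (2 * B ^ 3 + 6 * B * A) / s ^ 2 := by
    rw [abs_div, abs_mul, abs_of_pos (show 0 < s ^ 3 by positivity),
      abs_of_nonneg (show 0 ≤ 2 * b ^ 3 + 6 * b * c ^ 2 by positivity)]
    rw [div_le_div_iff₀ (by positivity) (by positivity)]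
    have : 2 * b ^ 3 + 6 * b * c ^ 2 ≤ (2 * B ^ 3 + 6 * B * A) * s := by
      have h1 : b ^ 3 ≤ B ^ 3 := by gcongr
      have h2 : b * c ^ 2 ≤ B * (A * s) := by gcongr
      have h3 : B ^ 3 ≤ B ^ 3 * s := le_mul_of_one_le_right (by positivity) hs1
      nlinarith
    calc |γ| * (2 * b ^ 3 + 6 * b * c ^ 2) * s ^ 2
        ≤ |γ| * ((2 * B ^ 3 + 6 * B * A) * s) * s ^ 2 := by gcongr
      _ = _ := by ring
  have e3 : M * ((b + c) / s) ^ 4 + M * ((b - c) / s) ^ 4 ≤ M * (2 * (8 * (B ^ 4 + A ^ 2))) / s ^ 2 := by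
    have h4 : (b + c) ^ 4 + (b - c) ^ 4 ≤ 2 * (8 * (B ^ 4 + A ^ 2)) * s ^ 2 := by
      have i1 : c ^ 4 ≤ A ^ 2 * s ^ 2 := by
        calc c ^ 4 = (c ^ 2) ^ 2 := by ring
          _ ≤ (A * s) ^ 2 := by gcongr
          _ = _ := by ring
      have i2 : b ^ 4 ≤ B ^ 4 * s ^ 2 := by
        calc b ^ 4 ≤ B ^ 4 := by gcongr
          _ ≤ _ := le_mul_of_one_le_right (by positivity) (one_le_pow₀ hs1)
      have i3 : (b + c) ^ 4 + (b - c) ^ 4 ≤ 8 * (b ^ 4 + c ^ 4) := by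
        linarith [mul_nonneg (show (0:ℝ) ≤ 6 by norm_num) (sq_nonneg (b ^ 2 - c ^ 2)),
          (show 8 * (b ^ 4 + c ^ 4) - ((b + c) ^ 4 + (b - c) ^ 4) = 6 * (b ^ 2 - c ^ 2) ^ 2 by ring)]
      have i4 : 0 ≤ (B ^ 4 + A ^ 2) * s ^ 2 := by positivity
      linarith
    rw [div_pow, div_pow, ← mul_add, ← add_div, mul_div_assoc M]
    refine mul_le_mul_of_nonneg_left ?_ hM
    rw [div_le_div_iff₀ (by positivity) (by positivity)]
    calc ((b + c) ^ 4 + (b - c) ^ 4) * s ^ 2 ≤ 2 * (8 * (B ^ 4 + A ^ 2)) * s ^ 2 * s ^ 2 := by gcongr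
      _ = _ := by ring
  have : X + Y - (2 - 2 * β * b / s + β * (β + 1) * c ^ 2 / s ^ 2)
      = (X - a1) + (Y - a2) + β * (β + 1) * b ^ 2 / s ^ 2
        + γ * (2 * b ^ 3 + 6 * b * c ^ 2) / s ^ 3 := by linarith
  rw [this, add_div, add_div]
  refine (abs_add_le _ _).trans ?_
  have := abs_add_le ((X - a1) + (Y - a2)) (β * (β + 1) * b ^ 2 / s ^ 2)
  have := abs_add_le (X - a1) (Y - a2)
  linarith

/-- anisotropic quadratic form -/
def qf {d : ℕ} (p : Fin d → ℝ) (y : Fin d → ℤ) : ℝ := ∑ i, (y i : ℝ) ^ 2 / p i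

lemma sum_sq_add {d : ℕ} (a : Fin d → ℝ) (y : Fin d → ℤ) (i : Fin d) :
    (∑ j, ((y + unitVec i) j : ℝ) ^ 2 * a j) = (∑ j, (y j : ℝ) ^ 2 * a j) + (1 + 2 * y i) * a i ∧
    (∑ j, ((y - unitVec i) j : ℝ) ^ 2 * a j) = (∑ j, (y j : ℝ) ^ 2 * a j) + (1 - 2 * y i) * a i := by
  constructor
  · have : ∀ j, ((y + unitVec i) j : ℝ) ^ 2 * a j = (y j : ℝ) ^ 2 * a j +
        (if j = i then (1 + 2 * y i) * a i else 0) := by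
      intro j
      simp only [Pi.add_apply, unitVec]
      split_ifs with h
      · subst h; push_cast; ring
      · push_cast; ring
    simp_rw [this, Finset.sum_add_distrib]
    simp
  · have : ∀ j, ((y - unitVec i) j : ℝ) ^ 2 * a j = (y j : ℝ) ^ 2 * a j +
        (if j = i then (1 - 2 * y i) * a i else 0) := by
      intro j
      simp only [Pi.sub_apply, unitVec]
      split_ifs with h
      · subst h; push_cast; ring
      · push_cast; ring
    simp_rw [this, Finset.sum_add_distrib]
    simp

lemma qf_add {d : ℕ} (p : Fin d → ℝ) (y : Fin d → ℤ) (i : Fin d) :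
    qf p (y + unitVec i) = qf p y + 1 / p i + 2 * y i / p i ∧
    qf p (y - unitVec i) = qf p y + 1 / p i - 2 * y i / p i := by
  obtain ⟨h1, h2⟩ := sum_sq_add (fun i => (p i)⁻¹) y i
  simp only [qf, div_eq_mul_inv]
  constructor
  · rw [h1]; ring
  · rw [h2]; ring

/-- hypothesis on kernels -/
structure GoodK {d : ℕ} (p : Fin d → ℝ) : Prop where
  lo : ∀ i, 1 / (4 * (d:ℝ)) ≤ p i
  hi : ∀ i, p i ≤ 1 / (d:ℝ)
  sm : ∑ i, 2 * p i = 1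

lemma GoodK.pos {d : ℕ} (hd : 0 < d) {p : Fin d → ℝ} (hp : GoodK p) (i : Fin d) : 0 < p i := by
  have : (0:ℝ) < d := by exact_mod_cast hd
  exact lt_of_lt_of_le (by positivity) (hp.lo i)

lemma GoodK.inv_le {d : ℕ} (hd : 0 < d) {p : Fin d → ℝ} (hp : GoodK p) (i : Fin d) :
    1 / p i ≤ 4 * d := by
  have h : (0:ℝ) < d := by exact_mod_cast hd
  have := hp.lo i
  rw [div_le_iff₀ (by positivity)] at this
  rw [div_le_iff₀ (hp.pos hd i)]
  linarith

lemma GoodK.csq {d : ℕ} (hd : 0 < d) {p : Fin d → ℝ} (hp : GoodK p) (y : Fin d → ℤ) (i : Fin d) :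
    (2 * y i / p i) ^ 2 ≤ 16 * d * qf p y := by
  have h1 : (y i : ℝ) ^ 2 / p i ≤ qf p y := by
    unfold qf
    exact Finset.single_le_sum (f := fun i => (y i : ℝ) ^ 2 / p i)
      (fun j _ => div_nonneg (sq_nonneg _) (hp.pos hd j).le) (Finset.mem_univ i)
  have h2 : (2 * y i / p i) ^ 2 = 4 * (1 / p i) * ((y i : ℝ) ^ 2 / p i) := by
    have := (hp.pos hd i).ne'
    field_simp; ring
  have h0 : 0 ≤ (y i : ℝ) ^ 2 / p i := div_nonneg (sq_nonneg _) (hp.pos hd i).le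
  rw [h2]
  calc 4 * (1 / p i) * ((y i : ℝ) ^ 2 / p i) ≤ 4 * (4 * d) * qf p y := by
        gcongr
        exact hp.inv_le hd i
    _ = _ := by ring

/-- main computation -/
lemma laplace_est (d : ℕ) (hd : 3 ≤ d) : ∃ C S : ℝ, 0 ≤ C ∧ 1 ≤ S ∧
    ∀ p : Fin d → ℝ, GoodK p → ∀ (y w : Fin d → ℤ) (κ : ℝ), S ≤ qf p (y - w) + κ →
      qf p (y - w) ≤ 2 * (qf p (y - w) + κ) →
      |stepOp p (fun y => (qf p (y - w) + κ) ^ (-(((d:ℝ) - 2) / 2))) y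
        - (qf p (y - w) + κ) ^ (-(((d:ℝ) - 2) / 2)) * (1 - d * (d - 2) * κ / (qf p (y - w) + κ) ^ 2)|
        ≤ C * ((qf p (y - w) + κ) ^ (-(((d:ℝ) - 2) / 2)) / (qf p (y - w) + κ) ^ 2) := by
  have hd0 : 0 < d := by omega
  have hdR : (3:ℝ) ≤ d := by exact_mod_cast hd
  set β : ℝ := ((d:ℝ) - 2) / 2 with hβ
  obtain ⟨C, S, hC, hS, H⟩ := rpow_second_diff β (32 * d) (4 * d) (by rw [hβ]; linarith)
    (by positivity) (by positivity)
  refine ⟨C, S, hC, hS, ?_⟩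
  intro p hp y w κ hs hq
  set x := y - w with hx
  set s := qf p x + κ with hsd
  have hs0 : 0 < s := by linarith
  have hterm : ∀ i, |(s + 1 / p i + 2 * x i / p i) ^ (-β) + (s + 1 / p i - 2 * x i / p i) ^ (-β)
        - s ^ (-β) * (2 - 2 * β * (1 / p i) / s + β * (β + 1) * (2 * x i / p i) ^ 2 / s ^ 2)|
        ≤ C * (s ^ (-β) / s ^ 2) := by
    intro i
    apply H _ _ _ hs
    · have := (hp.pos hd0 i); positivity
    · exact hp.inv_le hd0 i
    · have := hp.csq hd0 x i
      nlinarith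
  have hmain : ∑ i, p i * (s ^ (-β) * (2 - 2 * β * (1 / p i) / s + β * (β + 1) * (2 * x i / p i) ^ 2 / s ^ 2))
      = s ^ (-β) * (1 - d * (d - 2) * κ / s ^ 2) := by
    have e : ∀ i, p i * (s ^ (-β) * (2 - 2 * β * (1 / p i) / s + β * (β + 1) * (2 * x i / p i) ^ 2 / s ^ 2))
       = s ^ (-β) * (2 * p i) - s ^ (-β) * (2 * β / s) +
          s ^ (-β) * (4 * β * (β + 1) / s ^ 2) * ((x i : ℝ) ^ 2 / p i) := by
      intro i
      have := (hp.pos hd0 i).ne'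
      field_simp
      ring
    simp_rw [e]
    rw [Finset.sum_add_distrib, Finset.sum_sub_distrib, ← Finset.mul_sum, hp.sm]
    have hq' : ∑ i, ((x i : ℝ) ^ 2 / p i) = s - κ := by rw [hsd, qf]; ring
    rw [← Finset.mul_sum Finset.univ (fun i => (x i : ℝ) ^ 2 / p i), hq']
    simp only [Finset.sum_const, Finset.card_univ, Fintype.card_fin, nsmul_eq_mul]
    have hd2 : (d:ℝ) = 2 * β + 2 := by rw [hβ]; ring
    rw [hd2]
    field_simp
    ring
  rw [← hmain]
  have hst : stepOp p (fun y => (qf p (y - w) + κ) ^ (-β)) y =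
      ∑ i, p i * ((s + 1 / p i + 2 * x i / p i) ^ (-β) + (s + 1 / p i - 2 * x i / p i) ^ (-β)) := by
    unfold stepOp
    refine Finset.sum_congr rfl fun i _ => ?_
    have h1 := (qf_add p x i).1
    have h2 := (qf_add p x i).2
    have e1 : y + unitVec i - w = x + unitVec i := by rw [hx]; abel
    have e2 : y - unitVec i - w = x - unitVec i := by rw [hx]; abel
    simp only [e1, e2, h1, h2]
    rw [hsd]
    congr 3 <;> ring
  rw [hst, ← Finset.sum_sub_distrib]
  refine (Finset.abs_sum_le_sum_abs _ _).trans ?_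
  have hb : ∀ i ∈ Finset.univ, |p i * ((s + 1 / p i + 2 * x i / p i) ^ (-β) + (s + 1 / p i - 2 * x i / p i) ^ (-β))
      - p i * (s ^ (-β) * (2 - 2 * β * (1 / p i) / s + β * (β + 1) * (2 * x i / p i) ^ 2 / s ^ 2))|
      ≤ (2 * p i) * (C * (s ^ (-β) / s ^ 2)) := by
    intro i _
    have hpi := hp.pos hd0 i
    have hX : 0 ≤ C * (s ^ (-β) / s ^ 2) := by positivity
    rw [← mul_sub, abs_mul, abs_of_pos hpi]
    have := mul_le_mul_of_nonneg_left (hterm i) hpi.le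
    nlinarith
  refine (Finset.sum_le_sum hb).trans ?_
  rw [← Finset.sum_mul, hp.sm, one_mul]



/-- squared Euclidean norm -/
def nsq {d : ℕ} (y : Fin d → ℤ) : ℝ := ∑ i, (y i : ℝ) ^ 2

lemma nsq_nonneg {d : ℕ} (y : Fin d → ℤ) : 0 ≤ nsq y := Finset.sum_nonneg fun _ _ => sq_nonneg _

lemma znorm_sq {d : ℕ} (y : Fin d → ℤ) : znorm y ^ 2 = nsq y := Real.sq_sqrt (nsq_nonneg y)

lemma znorm_nonneg {d : ℕ} (y : Fin d → ℤ) : 0 ≤ znorm y := Real.sqrt_nonneg _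

lemma nsq_add {d : ℕ} (y : Fin d → ℤ) (i : Fin d) :
    nsq (y + unitVec i) = nsq y + (1 + 2 * y i) ∧ nsq (y - unitVec i) = nsq y + (1 - 2 * y i) := by
  have := sum_sq_add (fun _ => 1) y i
  simpa [nsq] using this

lemma znorm_eq {d : ℕ} (y : Fin d → ℤ) :
    znorm y = ‖(WithLp.toLp 2 (fun i => (y i : ℝ)) : EuclideanSpace ℝ (Fin d))‖ := by
  rw [EuclideanSpace.norm_eq, znorm]
  simp

lemma znorm_add_le {d : ℕ} (x y : Fin d → ℤ) : znorm (x + y) ≤ znorm x + znorm y := by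
  rw [znorm_eq, znorm_eq x, znorm_eq y]
  refine le_trans (le_of_eq ?_) (norm_add_le _ _)
  congr 1
  ext i
  simp

lemma znorm_neg {d : ℕ} (x : Fin d → ℤ) : znorm (-x) = znorm x := by
  simp [znorm]

lemma znorm_sub_le {d : ℕ} (x y : Fin d → ℤ) : znorm (x - y) ≤ znorm x + znorm y := by
  rw [sub_eq_add_neg, ← znorm_neg y]; exact znorm_add_le _ _

lemma znorm_le_sub {d : ℕ} (x y : Fin d → ℤ) : znorm x ≤ znorm (x - y) + znorm y := by
  have := znorm_add_le (x - y) y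
  rwa [sub_add_cancel] at this

lemma znorm_unit {d : ℕ} (i : Fin d) : znorm (unitVec i : Fin d → ℤ) = 1 := by
  have h := (nsq_add (0 : Fin d → ℤ) i).1
  have h0 : nsq (0 : Fin d → ℤ) = 0 := by simp [nsq]
  rw [zero_add, h0] at h
  have : znorm (unitVec i : Fin d → ℤ) = Real.sqrt (nsq (unitVec i)) := rfl
  rw [this, h]; simp

lemma ball_finite (d : ℕ) (L : ℝ) : {y : Fin d → ℤ | znorm y ≤ L}.Finite := by
  by_cases hL : 0 ≤ L
  swap
  · convert Set.finite_empty
    ext y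
    simp only [Set.mem_ofPred_eq, Set.mem_empty_iff_false, iff_false]
    linarith [znorm_nonneg y]
  refine (Set.finite_Icc (fun _ : Fin d => -⌈L⌉) (fun _ : Fin d => ⌈L⌉)).subset ?_
  intro y hy
  have h : ∀ i, |(y i : ℝ)| ≤ ⌈L⌉ := by
    intro i
    have h1 : (y i : ℝ) ^ 2 ≤ nsq y :=
      Finset.single_le_sum (f := fun i => (y i : ℝ) ^ 2) (fun _ _ => sq_nonneg _) (Finset.mem_univ i)
    have h2 : nsq y ≤ L ^ 2 := by
      rw [← znorm_sq]; exact pow_le_pow_left₀ (znorm_nonneg y) hy 2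
    exact (abs_le_of_sq_le_sq (h1.trans h2) hL).trans (Int.le_ceil L)
  constructor
  · intro i
    have := (abs_le.1 (h i)).1
    exact_mod_cast this
  · intro i
    have := (abs_le.1 (h i)).2
    exact_mod_cast this

lemma qf_bounds {d : ℕ} (hd : 0 < d) {p : Fin d → ℝ} (hp : GoodK p) (y : Fin d → ℤ) :
    d * nsq y ≤ qf p y ∧ qf p y ≤ 4 * d * nsq y := by
  have hdR : (0:ℝ) < d := by exact_mod_cast hd
  unfold nsq qf
  rw [Finset.mul_sum, Finset.mul_sum]
  constructor
  · refine Finset.sum_le_sum fun i _ => ?_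
    rw [le_div_iff₀ (hp.pos hd i)]
    have := hp.hi i
    rw [le_div_iff₀ hdR] at this
    nlinarith [sq_nonneg (y i : ℝ)]
  · refine Finset.sum_le_sum fun i _ => ?_
    have := hp.inv_le hd i
    rw [div_eq_mul_one_div, mul_comm]
    gcongr

/-- uniform upper bound on Green functions -/
lemma green_upper (d : ℕ) (hd : 3 ≤ d) : ∃ C1 > (0:ℝ), ∀ p : Fin d → ℝ, GoodK p →
    ∀ V : Set (Fin d → ℤ), V.Finite → ∀ x g, IsGreen p V x g →
      ∀ (y : Fin d → ℤ) (R : ℝ), y ∈ V → 0 < R → R ≤ nsq (y - x) →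
        g y ≤ C1 * R ^ (-(((d:ℝ) - 2) / 2)) := by
  have hd0 : 0 < d := by omega
  have hdR : (3:ℝ) ≤ d := by exact_mod_cast hd
  obtain ⟨C, S, hC, hS, H⟩ := laplace_est d hd
  set β : ℝ := ((d:ℝ) - 2) / 2 with hβ
  have hβ0 : 0 < β := by rw [hβ]; linarith
  set K := max S (C + 1) with hK
  have hKS : S ≤ K := le_max_left _ _
  have hKC : C + 1 ≤ K := le_max_right _ _
  have hK0 : 0 < K := by linarith
  have hKβ : 0 < K ^ (-β) := Real.rpow_pos_of_pos hK0 _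
  refine ⟨(K ^ (-β) / K ^ 2)⁻¹, by positivity, ?_⟩
  intro p hp V hV x g hg y R hy hR hRy
  set C1 := (K ^ (-β) / K ^ 2)⁻¹ with hC1
  have hC10 : 0 < C1 := by positivity
  have hqn : ∀ y, 0 ≤ qf p y := fun y =>
    le_trans (mul_nonneg (by positivity) (nsq_nonneg y)) (qf_bounds hd0 hp y).1
  have hsup : ∀ y, stepOp p (fun y => (qf p (y - x) + K) ^ (-β)) y ≤
      (qf p (y - x) + K) ^ (-β) - (qf p (y - x) + K) ^ (-β) / (qf p (y - x) + K) ^ 2 := by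
    intro y
    have hq := hqn (y - x)
    have h := (abs_le.1 (H p hp y x K (by linarith) (by linarith))).2
    set s := qf p (y - x) + K
    have hs : 0 < s := by linarith
    have hT : 0 ≤ s ^ (-β) / s ^ 2 := by positivity
    have e : s ^ (-β) * (1 - d * (d - 2) * K / s ^ 2) = s ^ (-β) - d * (d - 2) * K * (s ^ (-β) / s ^ 2) := by
      ring
    rw [e] at h
    have : C + 1 ≤ d * (d - 2) * K := by
      have : (1:ℝ) ≤ d * (d - 2) := by nlinarith
      nlinarith
    nlinarith
  have hmp := max_principle hd0 p (hp.pos hd0) hp.sm V hV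
    (fun y => g y - C1 * (qf p (y - x) + K) ^ (-β)) ?_ ?_ y hy
  · have h1 : (qf p (y - x) + K) ^ (-β) ≤ R ^ (-β) := by
      apply Real.rpow_le_rpow_of_nonpos hR _ (by linarith)
      have := (qf_bounds hd0 hp (y - x)).1
      have := nsq_nonneg (y - x)
      nlinarith
    have := mul_le_mul_of_nonneg_left h1 hC10.le
    linarith
  · intro y hy
    rw [stepOp_sub, stepOp_smul, hg.2 y hy]
    have h := hsup y
    have hs : 0 < qf p (y - x) + K := by linarith [hqn (y - x)]
    have hT : 0 ≤ (qf p (y - x) + K) ^ (-β) / (qf p (y - x) + K) ^ 2 := by positivity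
    split_ifs with hyx
    · subst hyx
      have q0 : qf p (y - y) = 0 := by simp [qf]
      rw [q0, zero_add] at h ⊢
      have h2 : C1 * (K ^ (-β) / K ^ 2) = 1 := inv_mul_cancel₀ (by positivity)
      have := mul_le_mul_of_nonneg_left h hC10.le
      linarith [mul_sub C1 (K ^ (-β)) (K ^ (-β) / K ^ 2)]
    · have := mul_le_mul_of_nonneg_left (h.trans (sub_le_self _ hT)) hC10.le
      linarith
  · have : ∀ y, y ∉ V → g y - C1 * (qf p (y - x) + K) ^ (-β) ≤ 0 := by
      intro y hy
      rw [hg.1 y hy]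
      have hs : 0 < qf p (y - x) + K := by linarith [hqn (y - x)]
      have : 0 ≤ C1 * (qf p (y - x) + K) ^ (-β) := by positivity
      linarith
    exact fun y _ i => ⟨fun h => this _ h, fun h => this _ h⟩

lemma green_superharm {d : ℕ} {p : Fin d → ℝ} {V : Set (Fin d → ℤ)} {b : Fin d → ℤ}
    {g : (Fin d → ℤ) → ℝ} (hg : IsGreen p V b g) : ∀ y ∈ V, stepOp p g y ≤ g y := by
  intro y hy
  rw [hg.2 y hy]; split_ifs <;> linarith

/-- the Green function near the pole -/
lemma green_near {d : ℕ} (hd : 0 < d) {p : Fin d → ℝ} (hp : GoodK p)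
    {V : Set (Fin d → ℤ)} (hV : V.Finite) {w : Fin d → ℤ} {g : (Fin d → ℤ) → ℝ}
    (hg : IsGreen p V w g) (N : ℕ) (hN : ∀ y, nsq (y - w) ≤ N → y ∈ V) :
    ∀ n : ℕ, n ≤ N → ∀ y, nsq (y - w) ≤ n → (1 / (4 * (d:ℝ))) ^ n ≤ g y := by
  have hdR : (1:ℝ) ≤ d := by exact_mod_cast hd
  have hc1 : 1 / (4 * (d:ℝ)) ≤ 1 := by
    rw [div_le_one (by positivity)]; linarith
  have hgn := hg.nonneg hd (hp.pos hd) hp.sm hV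
  have hpn : ∀ i, 0 ≤ p i := fun i => (hp.pos hd i).le
  have hw : ∀ n : ℕ, (1 / (4 * (d:ℝ))) ^ n ≤ g w := by
    intro n
    have hwV : w ∈ V := hN w (by simp [nsq])
    have h1 : (1:ℝ) ≤ g w := by
      rw [hg.2 w hwV, if_pos rfl]
      have := stepOp_mono p hpn (f := fun _ => 0) w hgn
      rw [stepOp_const p hp.sm 0 w] at this
      linarith
    exact (pow_le_one₀ (by positivity) hc1).trans h1
  intro n
  induction n with
  | zero =>
    intro _ y hy
    have : y = w := by
      have h0 : nsq (y - w) = 0 := le_antisymm (by simpa using hy) (nsq_nonneg _)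
      funext i
      have := (Finset.sum_eq_zero_iff_of_nonneg (fun i _ => sq_nonneg (((y - w) i : ℤ) : ℝ))).1 h0 i
        (Finset.mem_univ i)
      have h2 : (y - w) i = 0 := by exact_mod_cast pow_eq_zero_iff (two_ne_zero) |>.1 this
      simp only [Pi.sub_apply] at h2
      linarith
    rw [this]; exact hw 0
  | succ n ih =>
    intro hnN y hy
    by_cases hyw : y = w
    · rw [hyw]; exact hw _
    have hyV : y ∈ V := hN y (hy.trans (by exact_mod_cast hnN))
    obtain ⟨i, hi⟩ : ∃ i, (y - w) i ≠ 0 := by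
      by_contra! h
      apply hyw
      funext i
      have := h i
      simp only [Pi.sub_apply] at this
      linarith
    obtain ⟨h1, h2⟩ := nsq_add (y - w) i
    obtain ⟨s1, s2⟩ := stepOp_ge_add p hpn y hgn i
    have hsup := green_superharm hg y hyV
    push_cast at hy
    have fin : ∀ t, (1 / (4 * (d:ℝ))) ^ n ≤ t → (1 / (4 * (d:ℝ))) ^ (n + 1) ≤ p i * t := by
      intro t ht
      rw [pow_succ, mul_comm]
      exact mul_le_mul (hp.lo i) ht (by positivity) (hpn i)
    rcases lt_or_gt_of_ne hi with hneg | hpos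
    · have hk : (((y - w) i : ℤ) : ℝ) ≤ -1 := by exact_mod_cast (by omega : (y - w) i ≤ -1)
      have := fin _ (ih (by omega) (y + unitVec i) (by
        rw [show y + unitVec i - w = y - w + unitVec i by abel, h1]; linarith))
      linarith
    · have hk : (1:ℝ) ≤ (((y - w) i : ℤ) : ℝ) := by exact_mod_cast hpos
      have := fin _ (ih (by omega) (y - unitVec i) (by
        rw [show y - unitVec i - w = y - w - unitVec i by abel, h2]; linarith))
      linarith



set_option maxHeartbeats 1000000 in
/-- lower bound on Green functions in the bulk -/
lemma green_lower (d : ℕ) (hd : 3 ≤ d) : ∃ c1 > (0:ℝ), ∃ L1 : ℝ, 1 ≤ L1 ∧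
    ∀ p : Fin d → ℝ, GoodK p → ∀ L : ℝ, L1 ≤ L → ∀ w : Fin d → ℤ, znorm w ≤ L / 8 →
      ∀ g, IsGreen p {y : Fin d → ℤ | znorm y ≤ L} w g →
        ∀ y : Fin d → ℤ, znorm y ≤ L / 8 → c1 * (L ^ 2) ^ (-(((d:ℝ) - 2) / 2)) ≤ g y := by
  have hd0 : 0 < d := by omega
  have hdR : (3:ℝ) ≤ d := by exact_mod_cast hd
  obtain ⟨C, S, hC, hS, H⟩ := laplace_est d hd
  set β : ℝ := ((d:ℝ) - 2) / 2 with hβ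
  have hβ0 : 0 < β := by rw [hβ]; linarith
  set K := max (max S (C + 1)) (128 * d) with hK
  have hKS : S ≤ K := (le_max_left _ _).trans (le_max_left _ _)
  have hKC : C + 1 ≤ K := (le_max_right _ _).trans (le_max_left _ _)
  have hKd : 128 * (d:ℝ) ≤ K := le_max_right _ _
  have hK0 : 0 < K := by linarith
  have hKβ : 0 < K ^ (-β) := Real.rpow_pos_of_pos hK0 _
  set N := ⌈3 * K⌉₊ with hN
  have hNK : 3 * K ≤ N := Nat.le_ceil _
  set cs := (1 / (4 * (d:ℝ))) ^ N with hcs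
  have hcs0 : 0 < cs := by positivity
  set m := cs / K ^ (-β) with hm
  have hm0 : 0 < m := by positivity
  have hgap : 0 < ((d:ℝ) / 4) ^ (-β) - ((d:ℝ) / 2) ^ (-β) := by
    have := Real.rpow_lt_rpow_of_neg (x := (d:ℝ) / 4) (y := (d:ℝ) / 2) (z := -β) (by linarith)
      (by linarith) (by linarith)
    linarith
  refine ⟨min cs (m * (((d:ℝ) / 4) ^ (-β) - ((d:ℝ) / 2) ^ (-β))), by positivity,
    max 1 (max (4 * K) (2 * N)), le_max_left _ _, ?_⟩
  intro p hp L hL w hw g hg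
  have hL1 : 1 ≤ L := (le_max_left _ _).trans hL
  have hL2 : 4 * K ≤ L := ((le_max_left _ _).trans (le_max_right _ _)).trans hL
  have hL3 : 2 * (N:ℝ) ≤ L := ((le_max_right _ _).trans (le_max_right _ _)).trans hL
  have hLK : 16 * K ≤ L ^ 2 := by nlinarith
  set V := {y : Fin d → ℤ | znorm y ≤ L} with hVd
  have hV : V.Finite := ball_finite d L
  have hVmem : ∀ y, y ∈ V ↔ znorm y ≤ L := fun y => Iff.rfl
  have hgn := hg.nonneg hd0 (hp.pos hd0) hp.sm hV
  have hN1 : (1:ℝ) ≤ N := by linarith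
  have hnear : ∀ y, qf p (y - w) < 3 * K → cs ≤ g y := by
    intro y hy
    refine green_near hd0 hp hV hg N ?_ N le_rfl y ?_
    · intro y hy
      rw [hVmem]
      have h1 : znorm (y - w) ≤ N := by
        apply le_of_sq_le_sq _ (by positivity)
        rw [znorm_sq]; nlinarith
      have := znorm_le_sub y w
      linarith
    · have h1 := (qf_bounds hd0 hp (y - w)).1
      have h2 := nsq_nonneg (y - w)
      nlinarith
  set a := (d * L ^ 2 / 2 : ℝ) ^ (-β) with ha
  have ha0 : 0 < a := Real.rpow_pos_of_pos (by positivity) _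
  set D := {y : Fin d → ℤ | y ∈ V ∧ 3 * K ≤ qf p (y - w)} with hD
  have hDmem : ∀ y, y ∈ D ↔ (y ∈ V ∧ 3 * K ≤ qf p (y - w)) := fun y => Iff.rfl
  have hmp := max_principle hd0 p (hp.pos hd0) hp.sm D (hV.subset fun y hy => hy.1)
    (fun y => m * ((qf p (y - w) + -K) ^ (-β) - a) - g y) ?_ ?_
  · intro y hy
    have hLb : (L ^ 2) ^ (-β) ≤ 1 := by
      apply Real.rpow_le_one_of_one_le_of_nonpos _ (by linarith)
      nlinarith
    have hLb0 : 0 < (L ^ 2) ^ (-β) := Real.rpow_pos_of_pos (by positivity) _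
    by_cases hyq : qf p (y - w) < 3 * K
    · have h1 : min cs (m * (((d:ℝ) / 4) ^ (-β) - ((d:ℝ) / 2) ^ (-β))) ≤ cs := min_le_left _ _
      have h2 := hnear y hyq
      nlinarith
    · push Not at hyq
      have hyD : y ∈ D := ⟨by rw [hVmem]; linarith, hyq⟩
      have h1 := hmp y hyD
      have h2 : znorm (y - w) ≤ L / 4 := (znorm_sub_le y w).trans (by linarith)
      have h3 : nsq (y - w) ≤ (L / 4) ^ 2 := by
        rw [← znorm_sq]; exact pow_le_pow_left₀ (znorm_nonneg _) h2 2
      have h4 : (d / 4 * L ^ 2 : ℝ) ^ (-β) ≤ (qf p (y - w) + -K) ^ (-β) := by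
        apply Real.rpow_le_rpow_of_nonpos (by linarith) _ (by linarith)
        have := (qf_bounds hd0 hp (y - w)).2
        nlinarith
      have h5 : a = (d / 2 : ℝ) ^ (-β) * (L ^ 2) ^ (-β) := by
        rw [← Real.mul_rpow (by positivity) (by positivity), ha]; congr 1; ring
      rw [Real.mul_rpow (by positivity) (by positivity)] at h4
      have h6 : min cs (m * (((d:ℝ) / 4) ^ (-β) - ((d:ℝ) / 2) ^ (-β))) * (L ^ 2) ^ (-β) ≤
          (m * (((d:ℝ) / 4) ^ (-β) - ((d:ℝ) / 2) ^ (-β))) * (L ^ 2) ^ (-β) := by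
        gcongr; exact min_le_right _ _
      have h7 := mul_le_mul_of_nonneg_left h4 hm0.le
      rw [h5] at h1
      linarith
  · intro y hy
    rw [hDmem] at hy
    obtain ⟨hyV, hyq⟩ := hy
    have hyw : y ≠ w := by
      rintro rfl
      have : qf p (y - y) = 0 := by simp [qf]
      linarith
    rw [stepOp_sub, stepOp_smul, stepOp_sub, stepOp_const p hp.sm, hg.2 y hyV, if_neg hyw]
    have h := (abs_le.1 (H p hp y w (-K) (by linarith) (by linarith))).1
    set s := qf p (y - w) + -K
    have hs : 0 < s := by linarith
    have hT : 0 ≤ s ^ (-β) / s ^ 2 := by positivity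
    have e : s ^ (-β) * (1 - d * (d - 2) * (-K) / s ^ 2) = s ^ (-β) + d * (d - 2) * K * (s ^ (-β) / s ^ 2) := by
      ring
    rw [e] at h
    have h2 : C ≤ d * (d - 2) * K := by
      have : (1:ℝ) ≤ d * (d - 2) := by nlinarith
      linarith [le_mul_of_one_le_left hK0.le this]
    have h3 := mul_le_mul_of_nonneg_right h2 hT
    have h4 : s ^ (-β) ≤ stepOp p (fun y => (qf p (y - w) + -K) ^ (-β)) y := by linarith
    have h5 := mul_le_mul_of_nonneg_left (sub_le_sub_right h4 a) hm0.le
    linarith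
  · have key : ∀ y', y' ∉ D → 2 * K ≤ qf p (y' - w) →
        m * ((qf p (y' - w) + -K) ^ (-β) - a) - g y' ≤ 0 := by
      intro y' hy' hq
      by_cases hyV : y' ∈ V
      · have hlt : qf p (y' - w) < 3 * K := by
          by_contra hge
          exact hy' ⟨hyV, not_lt.1 hge⟩
        have h1 := hnear y' hlt
        have h2 : (qf p (y' - w) + -K) ^ (-β) ≤ K ^ (-β) :=
          Real.rpow_le_rpow_of_nonpos hK0 (by linarith) (by linarith)
        have h3 : m * K ^ (-β) = cs := div_mul_cancel₀ _ hKβ.ne'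
        have h4 : m * ((qf p (y' - w) + -K) ^ (-β) - a) ≤ m * K ^ (-β) :=
          mul_le_mul_of_nonneg_left (by linarith) hm0.le
        linarith
      · have h0 := hgn y'
        have hL' : L < znorm y' := by rw [hVmem] at hyV; exact not_le.1 hyV
        have h1 := znorm_le_sub y' w
        have h2 : (7 / 8 * L) ^ 2 ≤ nsq (y' - w) := by
          rw [← znorm_sq]; exact pow_le_pow_left₀ (by positivity) (by linarith) 2
        have h3 := (qf_bounds hd0 hp (y' - w)).1
        have h4 : (qf p (y' - w) + -K) ^ (-β) ≤ a := by
          apply Real.rpow_le_rpow_of_nonpos (by positivity) _ (by linarith)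
          have h5 : (d:ℝ) * (7 / 8 * L) ^ 2 ≤ d * nsq (y' - w) := by gcongr
          nlinarith
        have : m * ((qf p (y' - w) + -K) ^ (-β) - a) ≤ 0 :=
          mul_nonpos_of_nonneg_of_nonpos hm0.le (by linarith)
        linarith
    intro y hy i
    rw [hDmem] at hy
    obtain ⟨h1, h2⟩ := qf_add p (y - w) i
    have hb : 0 < 1 / p i := one_div_pos.2 (hp.pos hd0 i)
    have hc : |2 * ((y - w) i : ℝ) / p i| ≤ qf p (y - w) / 3 := by
      apply abs_le_of_sq_le_sq _ (by linarith)
      have := hp.csq hd0 (y - w) i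
      nlinarith
    have hc' := abs_le.1 hc
    constructor
    · intro hn
      apply key _ hn
      rw [show y + unitVec i - w = y - w + unitVec i by abel, h1]; linarith
    · intro hn
      apply key _ hn
      rw [show y - unitVec i - w = y - w - unitVec i by abel, h2]; linarith

lemma two_add_sq_le (x : ℝ) : 2 + x ^ 2 ≤ Real.exp x + Real.exp (-x) := by
  have h1 : (x / 2) ^ 2 ≤ Real.sinh (x / 2) ^ 2 := by
    rcases le_total 0 (x / 2) with h | h
    · have := Real.self_le_sinh_iff.2 h
      nlinarith
    · have := Real.sinh_le_self_iff.2 h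
      nlinarith
  have h2 : Real.exp x + Real.exp (-x) = 2 + 4 * Real.sinh (x / 2) ^ 2 := by
    have e1 : Real.exp x = Real.exp (x / 2) ^ 2 := by
      rw [← Real.exp_nat_mul]; congr 1; push_cast; ring
    have e2 : Real.exp (-x) = Real.exp (-(x / 2)) ^ 2 := by
      rw [← Real.exp_nat_mul]; congr 1; push_cast; ring
    have e3 : Real.exp (x / 2) * Real.exp (-(x / 2)) = 1 := by
      rw [← Real.exp_add]; simp
    rw [e1, e2, Real.sinh_eq]
    linear_combination (2:ℝ) * e3
  rw [h2]; linarith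

/-- boundary barrier: lower bound -/
lemma barrier_lower {d : ℕ} (hd : 0 < d) {p : Fin d → ℝ} (hp : GoodK p) {L : ℝ} (hL1 : 1 ≤ L)
    (hL : 128 * (d:ℝ) ≤ L) {g : (Fin d → ℤ) → ℝ} (hg0 : ∀ y, 0 ≤ g y)
    (hgs : ∀ y, znorm y ≤ L → stepOp p g y ≤ g y) {m : ℝ} (hm : 0 ≤ m)
    (hgB : ∀ y, znorm y ≤ L / 8 → m ≤ g y) (y : Fin d → ℤ) (hy : znorm y ≤ L) :
    m * (Real.exp (-(128 * (d:ℝ))) * (128 * d) * ((L ^ 2 - nsq y) / L ^ 2)) ≤ g y := by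
  have hdR : (1:ℝ) ≤ d := by exact_mod_cast hd
  set lam : ℝ := 128 * (d:ℝ) with hlam
  have hlam0 : 0 < lam := by positivity
  have hL0 : 0 < L := by linarith
  set r := lam / L ^ 2 with hr
  have hr0 : 0 < r := by positivity
  have hr1 : r ≤ 1 := by
    rw [hr, div_le_one (by positivity)]; nlinarith
  have hu_lo : ∀ y : Fin d → ℤ, Real.exp (-lam) * lam * ((L ^ 2 - nsq y) / L ^ 2) ≤
      Real.exp (-(r * nsq y)) - Real.exp (-lam) := by
    intro y
    have e : Real.exp (-(r * nsq y)) = Real.exp (-lam) * Real.exp (lam * ((L ^ 2 - nsq y) / L ^ 2)) := by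
      rw [← Real.exp_add]; congr 1; rw [hr]; field_simp; ring
    have h := Real.add_one_le_exp (lam * ((L ^ 2 - nsq y) / L ^ 2))
    have h0 := Real.exp_pos (-lam)
    rw [e]
    have := mul_le_mul_of_nonneg_left h h0.le
    linarith
  have hu_hi : ∀ y : Fin d → ℤ, Real.exp (-(r * nsq y)) - Real.exp (-lam) ≤ 1 := by
    intro y
    have h0 := Real.exp_pos (-lam)
    have : Real.exp (-(r * nsq y)) ≤ 1 := by
      rw [Real.exp_le_one_iff]
      have := nsq_nonneg y
      have : 0 ≤ r * nsq y := by positivity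
      linarith
    linarith
  suffices hmain : m * (Real.exp (-(r * nsq y)) - Real.exp (-lam)) ≤ g y from
    (mul_le_mul_of_nonneg_left (hu_lo y) hm).trans hmain
  have hin : ∀ y, znorm y ≤ L / 8 → m * (Real.exp (-(r * nsq y)) - Real.exp (-lam)) - g y ≤ 0 := by
    intro y hy
    have := hgB y hy
    have := mul_le_mul_of_nonneg_left (hu_hi y) hm
    linarith
  have hout : ∀ y, ¬ znorm y ≤ L → m * (Real.exp (-(r * nsq y)) - Real.exp (-lam)) - g y ≤ 0 := by
    intro y hy
    have h1 : L ^ 2 ≤ nsq y := by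
      rw [← znorm_sq]; exact pow_le_pow_left₀ hL0.le (not_le.1 hy).le 2
    have h2 : Real.exp (-(r * nsq y)) ≤ Real.exp (-lam) := by
      apply Real.exp_le_exp.2
      have h3 : r * L ^ 2 = lam := by rw [hr]; field_simp
      nlinarith
    have := mul_nonpos_of_nonneg_of_nonpos hm (sub_nonpos.2 h2)
    linarith [hg0 y]
  by_cases hyB : znorm y ≤ L / 8
  · linarith [hin y hyB]
  set D := {y : Fin d → ℤ | znorm y ≤ L ∧ ¬ znorm y ≤ L / 8} with hD
  have hDmem : ∀ y, y ∈ D ↔ (znorm y ≤ L ∧ ¬ znorm y ≤ L / 8) := fun y => Iff.rfl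
  have hnD : ∀ y, y ∉ D → m * (Real.exp (-(r * nsq y)) - Real.exp (-lam)) - g y ≤ 0 := by
    intro y hy
    by_cases h1 : znorm y ≤ L
    · by_cases h2 : znorm y ≤ L / 8
      · exact hin y h2
      · exact absurd ((hDmem y).2 ⟨h1, h2⟩) hy
    · exact hout y h1
  have hmp := max_principle hd p (hp.pos hd) hp.sm D ((ball_finite d L).subset fun y hy => hy.1)
    (fun y => m * (Real.exp (-(r * nsq y)) - Real.exp (-lam)) - g y) ?_
    (fun y _ i => ⟨hnD _, hnD _⟩) y ⟨hy, hyB⟩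
  · linarith
  · intro y hy
    rw [hDmem] at hy
    obtain ⟨hy1, hy2⟩ := hy
    rw [stepOp_sub, stepOp_smul, stepOp_sub, stepOp_const p hp.sm]
    have h1 := hgs y hy1
    have h2 : Real.exp (-(r * nsq y)) ≤ stepOp p (fun y => Real.exp (-(r * nsq y))) y := by
      have e : ∀ i, Real.exp (-(r * nsq (y + unitVec i))) + Real.exp (-(r * nsq (y - unitVec i)))
          = Real.exp (-(r * nsq y)) * Real.exp (-r) * (Real.exp (2 * r * y i) + Real.exp (-(2 * r * y i))) := by
        intro i
        rw [(nsq_add y i).1, (nsq_add y i).2, mul_add (Real.exp _ * Real.exp _), ← Real.exp_add, ← Real.exp_add, ← Real.exp_add, add_comm]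
        congr 2 <;> ring
      have hE0 : 0 < Real.exp (-(r * nsq y)) * Real.exp (-r) := by positivity
      have h3 : Real.exp (-(r * nsq y)) * Real.exp (-r) * (1 + r ^ 2 * nsq y / d) ≤
          stepOp p (fun y => Real.exp (-(r * nsq y))) y := by
        unfold stepOp
        simp_rw [e]
        have hsum : Real.exp (-(r * nsq y)) * Real.exp (-r) * (1 + r ^ 2 * nsq y / d) =
            ∑ i, (Real.exp (-(r * nsq y)) * Real.exp (-r)) * (2 * p i + 1 / (4 * d) * (2 * r * y i) ^ 2) := by
          rw [← Finset.mul_sum, Finset.sum_add_distrib, hp.sm]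
          congr 2
          have : ∀ i, 1 / (4 * (d:ℝ)) * (2 * r * y i) ^ 2 = r ^ 2 / d * (y i : ℝ) ^ 2 := by
            intro i; field_simp; ring
          simp_rw [this]
          rw [← Finset.mul_sum, nsq]; ring
        rw [hsum]
        refine Finset.sum_le_sum fun i _ => ?_
        rw [mul_left_comm (p i)]
        refine mul_le_mul_of_nonneg_left ?_ hE0.le
        have h5 := two_add_sq_le (2 * r * y i)
        have h6 := mul_le_mul_of_nonneg_left h5 (hp.pos hd i).le
        have h7 := mul_le_mul_of_nonneg_right (hp.lo i) (sq_nonneg (2 * r * y i))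
        linarith
      refine le_trans ?_ h3
      have h8 : Real.exp r ≤ 1 + 2 * r := by
        have := Real.abs_exp_sub_one_le (x := r) (by rw [abs_of_pos hr0]; exact hr1)
        rw [abs_of_pos hr0] at this
        linarith [(abs_le.1 this).2]
      have h9 : (L / 8) ^ 2 ≤ nsq y := by
        rw [← znorm_sq]; exact pow_le_pow_left₀ (by positivity) (not_le.1 hy2).le 2
      have h10 : 2 * r ≤ r ^ 2 * nsq y / d := by
        rw [le_div_iff₀ (by positivity)]
        have h11 : r * L ^ 2 = 128 * d := by rw [hr, hlam]; field_simp
        have h12 : 2 * (d:ℝ) ≤ r * nsq y := by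
          have := mul_le_mul_of_nonneg_left h9 hr0.le
          linarith
        have := mul_le_mul_of_nonneg_left h12 hr0.le
        linarith
      have h13 : Real.exp (-r) * Real.exp r = 1 := by rw [← Real.exp_add]; simp
      calc Real.exp (-(r * nsq y)) = Real.exp (-(r * nsq y)) * Real.exp (-r) * Real.exp r := by
            rw [mul_assoc, h13, mul_one]
        _ ≤ _ := mul_le_mul_of_nonneg_left (by linarith) hE0.le
    have h3 := mul_le_mul_of_nonneg_left (sub_le_sub_right h2 (Real.exp (-lam))) hm
    linarith



/-- upper bound near the boundary -/
lemma green_upper_bdry (d : ℕ) (hd : 3 ≤ d) (η : ℝ) (hη0 : 0 < η) (hη1 : η < 1) :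
    ∃ C2 > (0:ℝ), ∃ L2 : ℝ, 1 ≤ L2 ∧ ∀ p : Fin d → ℝ, GoodK p → ∀ L : ℝ, L2 ≤ L →
      ∀ x : Fin d → ℤ, znorm x ≤ η * L → ∀ g, IsGreen p {y : Fin d → ℤ | znorm y ≤ L} x g →
        ∀ y : Fin d → ℤ, znorm y ≤ L → L - 1 ≤ znorm y →
          g y ≤ C2 * ((L ^ 2) ^ (-(((d:ℝ) - 2) / 2)) / L) := by
  have hd0 : 0 < d := by omega
  have hdR : (3:ℝ) ≤ d := by exact_mod_cast hd
  obtain ⟨C1, hC1, H⟩ := green_upper d hd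
  set β : ℝ := ((d:ℝ) - 2) / 2 with hβ
  set ρ := (1 - η) / 4 with hρ
  have hρ0 : 0 < ρ := by rw [hρ]; linarith
  set e := (1 + η) / 2 with he
  have he1 : e < 1 := by rw [he]; linarith
  have he0 : 0 < e := by rw [he]; linarith
  have hee : 0 < 1 - e ^ 2 := by nlinarith
  have hρβ : 0 < (ρ ^ 2) ^ (-β) := Real.rpow_pos_of_pos (by positivity) _
  refine ⟨4 * (C1 * (ρ ^ 2) ^ (-β)) / (1 - e ^ 2), by positivity, max 1 (1 / ρ), le_max_left _ _, ?_⟩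
  intro p hp L hL x hx g hg y hy hyL
  have hL1 : 1 ≤ L := (le_max_left _ _).trans hL
  have hL0 : 0 < L := by linarith
  have hL2 : 1 ≤ L * ρ := by
    have := (le_max_right _ _).trans hL
    rwa [div_le_iff₀ hρ0] at this
  set V := {y : Fin d → ℤ | znorm y ≤ L} with hVd
  have hV : V.Finite := ball_finite d L
  set T := C1 * (ρ ^ 2 * L ^ 2) ^ (-β) with hT
  have hT0 : 0 < T := mul_pos hC1 (Real.rpow_pos_of_pos (by positivity) _)
  set M := T / ((1 - e ^ 2) * L ^ 2) with hM
  have hM0 : 0 < M := by positivity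
  set D := {y : Fin d → ℤ | znorm y ≤ L ∧ e * L < znorm y} with hD
  have hDmem : ∀ y, y ∈ D ↔ (znorm y ≤ L ∧ e * L < znorm y) := fun y => Iff.rfl
  have hL2' : 1 ≤ (L - η * L) / 4 := by rw [hρ] at hL2; linarith
  have heL : e * L = (L + η * L) / 2 := by rw [he]; ring
  have hmp := max_principle hd0 p (hp.pos hd0) hp.sm D (hV.subset fun y hy => hy.1)
    (fun y => g y - M * ((L + 1) ^ 2 - nsq y)) ?_ ?_ y ⟨hy, by linarith⟩
  · have h1 : (L - 1) ^ 2 ≤ nsq y := by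
      rw [← znorm_sq]; exact pow_le_pow_left₀ (by linarith) hyL 2
    have h2 : M * ((L + 1) ^ 2 - nsq y) ≤ M * (4 * L) :=
      mul_le_mul_of_nonneg_left (by linarith) hM0.le
    have h3 : M * (4 * L) = 4 * (C1 * (ρ ^ 2) ^ (-β)) / (1 - e ^ 2) * ((L ^ 2) ^ (-β) / L) := by
      rw [hM, hT, Real.mul_rpow (by positivity) (by positivity)]
      field_simp
    linarith
  · intro y hy
    rw [hDmem] at hy
    have hyx : y ≠ x := by
      rintro rfl
      linarith [hy.2]
    rw [stepOp_sub, stepOp_smul, stepOp_sub, stepOp_const p hp.sm, hg.2 y hy.1, if_neg hyx]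
    have h1 : nsq y ≤ stepOp p nsq y := by
      have : stepOp p nsq y = ∑ i, (2 * p i * (nsq y + 1)) := by
        unfold stepOp
        refine Finset.sum_congr rfl fun i _ => ?_
        rw [(nsq_add y i).1, (nsq_add y i).2]; ring
      rw [this, ← Finset.sum_mul, hp.sm]; linarith
    have h2 := mul_le_mul_of_nonneg_left (sub_le_sub_left h1 ((L + 1) ^ 2)) hM0.le
    have h3 : stepOp p (fun y => nsq y) y = stepOp p nsq y := rfl
    rw [h3]
    linarith
  · have key : ∀ y', y' ∉ D → e * L - 1 ≤ znorm y' → znorm y' ≤ L + 1 →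
        g y' - M * ((L + 1) ^ 2 - nsq y') ≤ 0 := by
      intro y' hn h1 h2
      by_cases hyV : znorm y' ≤ L
      · have h3 : znorm y' ≤ e * L := by
          by_contra h
          exact hn ⟨hyV, not_le.1 h⟩
        have h4 : nsq y' ≤ (e * L) ^ 2 := by
          rw [← znorm_sq]; exact pow_le_pow_left₀ (znorm_nonneg _) h3 2
        have h5 : ρ * L ≤ znorm (y' - x) := by
          have := znorm_le_sub y' x
          have : ρ * L = (L - η * L) / 4 := by rw [hρ]; ring
          linarith
        have h6 : ρ ^ 2 * L ^ 2 ≤ nsq (y' - x) := by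
          rw [← znorm_sq, ← mul_pow]; exact pow_le_pow_left₀ (by positivity) h5 2
        have h7 : g y' ≤ T := H p hp V hV x g hg y' _ hyV (by positivity) h6
        have h8 : M * ((1 - e ^ 2) * L ^ 2) = T := div_mul_cancel₀ _ (by positivity)
        have h9 : M * ((1 - e ^ 2) * L ^ 2) ≤ M * ((L + 1) ^ 2 - nsq y') := by
          apply mul_le_mul_of_nonneg_left _ hM0.le
          nlinarith
        linarith
      · rw [hg.1 y' hyV]
        have h3 : nsq y' ≤ (L + 1) ^ 2 := by
          rw [← znorm_sq]; exact pow_le_pow_left₀ (znorm_nonneg _) h2 2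
        have := mul_nonneg hM0.le (sub_nonneg.2 h3)
        linarith
    intro y hy i
    rw [hDmem] at hy
    have hu := znorm_unit i
    constructor
    · intro hn
      have a1 := znorm_add_le y (unitVec i)
      have a2 := znorm_sub_le (y + unitVec i) (unitVec i)
      rw [add_sub_cancel_right] at a2
      exact key _ hn (by linarith [hy.2]) (by linarith [hy.1])
    · intro hn
      have a1 := znorm_sub_le y (unitVec i)
      have a2 := znorm_le_sub y (unitVec i)
      exact key _ hn (by linarith [hy.2]) (by linarith [hy.1])

/-- an inward step -/
lemma inward_step {d : ℕ} (hd : 0 < d) {p : Fin d → ℝ} (hp : GoodK p) {L : ℝ}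
    (hL : (d:ℝ) + 2 ≤ L) (y : Fin d → ℤ) (hy : znorm y ≤ L) (hy1 : L - 1 ≤ znorm y)
    {g : (Fin d → ℤ) → ℝ} (hg0 : ∀ y, 0 ≤ g y) (hgs : stepOp p g y ≤ g y) :
    ∃ y' : Fin d → ℤ, znorm y' ≤ L ∧ L / d ≤ L ^ 2 - nsq y' ∧ 1 / (4 * (d:ℝ)) * g y' ≤ g y := by
  have hdR : (1:ℝ) ≤ d := by exact_mod_cast hd
  have hL0 : 0 < L := by linarith
  obtain ⟨j, hj⟩ : ∃ j, nsq y ≤ d * (y j : ℝ) ^ 2 := by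
    obtain ⟨j, -, hj⟩ := Finset.exists_max_image Finset.univ (fun i => (y i : ℝ) ^ 2)
      ⟨⟨0, hd⟩, Finset.mem_univ _⟩
    refine ⟨j, ?_⟩
    have := Finset.sum_le_card_nsmul Finset.univ (fun i => (y i : ℝ) ^ 2) _ hj
    simpa [nsq] using this
  have h1 : L - 1 ≤ d * |(y j : ℝ)| := by
    refine hy1.trans ?_
    apply le_of_sq_le_sq _ (by positivity)
    rw [znorm_sq, mul_pow, sq_abs]
    nlinarith [sq_nonneg (y j : ℝ), mul_nonneg (by linarith : (0:ℝ) ≤ d - 1) (sq_nonneg (y j : ℝ))]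
  have h2 : L / d ≤ 2 * |(y j : ℝ)| - 1 := by
    rw [div_le_iff₀ (by positivity)]
    linarith
  have h3 : nsq y ≤ L ^ 2 := by
    rw [← znorm_sq]; exact pow_le_pow_left₀ (znorm_nonneg _) hy 2
  have hLd : 0 ≤ L / d := by positivity
  have hfin : ∀ y' : Fin d → ℤ, L / d ≤ L ^ 2 - nsq y' → znorm y' ≤ L := by
    intro y' h
    apply le_of_sq_le_sq _ hL0.le
    rw [znorm_sq]; linarith
  obtain ⟨s1, s2⟩ := stepOp_ge_add p (fun i => (hp.pos hd i).le) y hg0 j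
  rcases le_total 0 (y j : ℝ) with h | h
  · rw [abs_of_nonneg h] at h2
    have h4 : L / d ≤ L ^ 2 - nsq (y - unitVec j) := by rw [(nsq_add y j).2]; linarith
    exact ⟨y - unitVec j, hfin _ h4, h4,
      ((mul_le_mul_of_nonneg_right (hp.lo j) (hg0 _)).trans s2).trans hgs⟩
  · rw [abs_of_nonpos h] at h2
    have h4 : L / d ≤ L ^ 2 - nsq (y + unitVec j) := by rw [(nsq_add y j).1]; linarith
    exact ⟨y + unitVec j, hfin _ h4, h4,
      ((mul_le_mul_of_nonneg_right (hp.lo j) (hg0 _)).trans s1).trans hgs⟩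

/-- lower bound near the boundary -/
lemma green_lower_bdry (d : ℕ) (hd : 3 ≤ d) (η : ℝ) (hη0 : 0 < η) (hη1 : η < 1) :
    ∃ c2 > (0:ℝ), ∃ L2 : ℝ, 1 ≤ L2 ∧ ∀ p : Fin d → ℝ, GoodK p → ∀ L : ℝ, L2 ≤ L →
      ∀ x : Fin d → ℤ, znorm x ≤ η * L → ∀ g, IsGreen p {y : Fin d → ℤ | znorm y ≤ L} x g →
        ∀ y : Fin d → ℤ, znorm y ≤ L → L - 1 ≤ znorm y →
          c2 * ((L ^ 2) ^ (-(((d:ℝ) - 2) / 2)) / L) ≤ g y := by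
  have hd0 : 0 < d := by omega
  have hdR : (3:ℝ) ≤ d := by exact_mod_cast hd
  obtain ⟨c1, hc1, L1, hL1, H⟩ := green_lower d hd
  set β : ℝ := ((d:ℝ) - 2) / 2 with hβ
  set k := Real.exp (-(128 * (d:ℝ))) * (128 * d) with hk
  have hk0 : 0 < k := by positivity
  have hη2 : 0 < 1 - η ^ 2 := by nlinarith
  refine ⟨1 / (4 * (d:ℝ)) * ((c1 * (k * (1 - η ^ 2))) * (k * (1 / d))), by positivity,
    max L1 (128 * d), hL1.trans (le_max_left _ _), ?_⟩
  intro p hp L hL x hx g hg y hy hyL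
  have hLL1 : L1 ≤ L := (le_max_left _ _).trans hL
  have hLd : 128 * (d:ℝ) ≤ L := (le_max_right _ _).trans hL
  have hL0 : 1 ≤ L := by linarith
  have hV := ball_finite d L
  have hxL : znorm x ≤ L := hx.trans (by nlinarith)
  have hgn := hg.nonneg hd0 (hp.pos hd0) hp.sm hV
  have hLβ : 0 < (L ^ 2) ^ (-β) := Real.rpow_pos_of_pos (by positivity) _
  have hB : ∀ w, znorm w ≤ L / 8 → c1 * (L ^ 2) ^ (-β) * (k * (1 - η ^ 2)) ≤ g w := by
    intro w hw
    obtain ⟨gw, hgw⟩ := exists_green hd0 p (hp.pos hd0) hp.sm _ hV w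
    have hwL : znorm w ≤ L := by linarith
    have hs : g w = gw x := hg.symm hV hxL hgw
    rw [hs]
    have h1 := barrier_lower hd0 hp hL0 hLd (hgw.nonneg hd0 (hp.pos hd0) hp.sm hV)
      (fun y hy => green_superharm hgw y hy) (m := c1 * (L ^ 2) ^ (-β)) (by positivity)
      (fun y hy => H p hp L hLL1 w hw gw hgw y hy) x hxL
    refine le_trans ?_ h1
    have h2 : 1 - η ^ 2 ≤ (L ^ 2 - nsq x) / L ^ 2 := by
      rw [le_div_iff₀ (by positivity)]
      have : nsq x ≤ (η * L) ^ 2 := by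
        rw [← znorm_sq]; exact pow_le_pow_left₀ (znorm_nonneg _) hx 2
      linarith
    gcongr
  obtain ⟨y', hy', ht, hgy⟩ := inward_step hd0 hp (by linarith) y hy hyL hgn
    (green_superharm hg y hy)
  have h1 := barrier_lower hd0 hp hL0 hLd hgn (fun y hy => green_superharm hg y hy)
    (m := c1 * (L ^ 2) ^ (-β) * (k * (1 - η ^ 2))) (by positivity) hB y' hy'
  refine le_trans ?_ hgy
  have h2 : 1 / d / L ≤ (L ^ 2 - nsq y') / L ^ 2 := by
    rw [div_le_div_iff₀ (by positivity) (by positivity)]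
    calc 1 / (d:ℝ) * L ^ 2 = L / d * L := by ring
      _ ≤ _ := by gcongr
  have h3 : c1 * (L ^ 2) ^ (-β) * (k * (1 - η ^ 2)) * (k * (1 / d / L)) ≤ g y' := by
    refine le_trans ?_ h1
    gcongr
  calc _ = 1 / (4 * (d:ℝ)) * (c1 * (L ^ 2) ^ (-β) * (k * (1 - η ^ 2)) * (k * (1 / d / L))) := by ring
    _ ≤ _ := mul_le_mul_of_nonneg_left h3 (by positivity)

end Aux


/-- for `d ≥ 3`, `0 < η < 1` and symmetric nearest-neighbor kernels `p`
close enough to simple random walk, there is `C = C(d,η)` such that for large `L`, all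
`x ∈ V_{ηL}` and `z ∈ ∂V_L`: `C⁻¹ L^{-(d-1)} ≤ π_L^{(p)}(x,z) ≤ C L^{-(d-1)}`. -/
theorem stmt10 (d : ℕ) (hd : 3 ≤ d) :
    ∃ κ₀ > (0:ℝ), ∀ η : ℝ, 0 < η → η < 1 →
      ∃ C > (0:ℝ), ∃ L₀ : ℝ, 1 ≤ L₀ ∧ ∀ L : ℝ, L₀ ≤ L →
        ∀ p : Fin d → ℝ, (∀ i, 0 ≤ p i) → (∑ i, 2 * p i = 1) →
          (∀ i, |p i - 1/(2*(d:ℝ))| ≤ κ₀) →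
          ∀ x : Fin d → ℤ, znorm x ≤ η * L →
            ∀ z ∈ outerBoundary d L,
              C⁻¹ * L ^ (-(d:ℝ) + 1) ≤ exitProb p L x z ∧
              exitProb p L x z ≤ C * L ^ (-(d:ℝ) + 1) := by

  have hd0 : 0 < d := by omega
  have hdR : (3:ℝ) ≤ d := by exact_mod_cast hd
  refine ⟨1 / (4 * (d:ℝ)), by positivity, ?_⟩
  intro η hη0 hη1
  obtain ⟨C2, hC2, L2, hL2, HU⟩ := green_upper_bdry d hd η hη0 hη1
  obtain ⟨c2, hc2, L3, hL3, HL⟩ := green_lower_bdry d hd η hη0 hη1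
  set c3 := 1 / (4 * (d:ℝ)) * c2 with hc3
  have hc30 : 0 < c3 := by positivity
  refine ⟨max C2 c3⁻¹, lt_max_of_lt_left hC2, max L2 L3, hL2.trans (le_max_left _ _), ?_⟩
  intro L hL p hp0 hsum hclose x hx z hz
  have hp : GoodK p := by
    refine ⟨fun i => ?_, fun i => ?_, hsum⟩
    · have := (abs_le.1 (hclose i)).1
      have e : 1 / (2 * (d:ℝ)) = 2 * (1 / (4 * (d:ℝ))) := by field_simp; norm_num
      linarith
    · have := (abs_le.1 (hclose i)).2
      have e : 1 / (2 * (d:ℝ)) = 2 * (1 / (4 * (d:ℝ))) := by field_simp; norm_num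
      have e2 : 1 / (d:ℝ) = 4 * (1 / (4 * (d:ℝ))) := by field_simp
      have : 0 < 1 / (4 * (d:ℝ)) := by positivity
      linarith
  have hLL2 : L2 ≤ L := (le_max_left _ _).trans hL
  have hLL3 : L3 ≤ L := (le_max_right _ _).trans hL
  have hL1 : 1 ≤ L := hL2.trans hLL2
  have hL0 : 0 < L := by linarith
  have hV := ball_finite d L
  have hxL : znorm x ≤ L := hx.trans (by nlinarith)
  obtain ⟨hzL, i, hi⟩ := hz
  obtain ⟨g, hg⟩ := exists_green hd0 p (hp.pos hd0) hp.sm _ hV x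
  have hgn := hg.nonneg hd0 (hp.pos hd0) hp.sm hV
  rw [exitProb_eq_green p hp0 hsum L z x hV hzL hxL hg]
  have hpow : L ^ (-(d:ℝ) + 1) = (L ^ 2) ^ (-(((d:ℝ) - 2) / 2)) / L := by
    rw [← Real.rpow_natCast L 2, ← Real.rpow_mul hL0.le]
    nth_rewrite 3 [← Real.rpow_one L]
    rw [← Real.rpow_sub hL0]
    congr 1; push_cast; ring
  rw [hpow]
  set Q := (L ^ 2) ^ (-(((d:ℝ) - 2) / 2)) / L with hQ
  have hQ0 : 0 < Q := div_pos (Real.rpow_pos_of_pos (by positivity) _) hL0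
  have hn1 : ∀ i, L - 1 ≤ znorm (z + unitVec i) ∧ L - 1 ≤ znorm (z - unitVec i) := by
    intro i
    have hu := znorm_unit i
    have a1 := znorm_le_sub z (unitVec i)
    have a2 := znorm_sub_le (z + unitVec i) (unitVec i)
    rw [add_sub_cancel_right] at a2
    constructor <;> linarith
  constructor
  · have hlow : c3 * Q ≤ stepOp p g z := by
      obtain ⟨s1, s2⟩ := stepOp_ge_add p hp0 z hgn i
      have hlo := hp.lo i
      rcases hi with h | h
      · have h1 := HL p hp L hLL3 x hx g hg _ h (hn1 i).2
        calc c3 * Q = 1 / (4 * (d:ℝ)) * (c2 * Q) := by rw [hc3]; ring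
          _ ≤ p i * g (z - unitVec i) := mul_le_mul hlo h1 (by positivity) (hp0 i)
          _ ≤ _ := s2
      · have h1 := HL p hp L hLL3 x hx g hg _ h (hn1 i).1
        calc c3 * Q = 1 / (4 * (d:ℝ)) * (c2 * Q) := by rw [hc3]; ring
          _ ≤ p i * g (z + unitVec i) := mul_le_mul hlo h1 (by positivity) (hp0 i)
          _ ≤ _ := s1
    refine le_trans (mul_le_mul_of_nonneg_right ?_ hQ0.le) hlow
    have h5 := inv_anti₀ (inv_pos.2 hc30) (le_max_right C2 c3⁻¹)
    rwa [inv_inv] at h5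
  · have hb : ∀ y, L - 1 ≤ znorm y → g y ≤ C2 * Q := by
      intro y hy
      by_cases hyV : znorm y ≤ L
      · exact HU p hp L hLL2 x hx g hg y hyV hy
      · rw [hg.1 y hyV]; positivity
    have h1 : stepOp p g z ≤ C2 * Q := by
      rw [← stepOp_const p hsum (C2 * Q) z]
      unfold stepOp
      refine Finset.sum_le_sum fun i _ => ?_
      exact mul_le_mul_of_nonneg_left (add_le_add (hb _ (hn1 i).1) (hb _ (hn1 i).2)) (hp0 i)
    exact h1.trans (mul_le_mul_of_nonneg_right (le_max_left _ _) hQ0.le)
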